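/- arXiv:2310.04974 — 2 statements merged into one kernel-verified Lean document; each statement's English description precedes it below -/
import Mathlib

section
/- Let n and m be two relatively prime integers, both bigger than 1, and assume that n is relatively prime to φ(m), where φ is Euler's totient function. Then there is no cyclic Galois extension K/ℚ of degree n whose class group Cl(K) is cyclic of order m. -/
open NumberField

open scoped nonZeroDivisors

namespace ClassGroup

section Map

variable {R S : Type*} [CommRing R] [CommRing S] [IsDedekindDomain R] [IsDedekindDomain S]

/-- The homomorphism of class groups induced by a ring isomorphism of Dedekind domains. -/
noncomputable def mapRingEquiv (e : R ≃+* S) : ClassGroup R →* ClassGroup S :=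
  letI := (e : R →+* S).toAlgebra
  haveI : Module.IsTorsionFree R S :=
    Module.isTorsionFree_iff_algebraMap_injective.mpr e.injective
  extendedHom R S

theorem mapRingEquiv_mk0 (e : R ≃+* S) (I : (Ideal R)⁰) (J : (Ideal S)⁰)
    (h : (I : Ideal R).map (e : R →+* S) = J) : mapRingEquiv e (mk0 I) = mk0 J := by
  let _ := (e : R →+* S).toAlgebra
  have : Module.IsTorsionFree R S :=
    Module.isTorsionFree_iff_algebraMap_injective.mpr e.injective
  exact (extendedHom_mk0 R S I).trans (congrArg mk0 (Subtype.ext h))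

theorem map_mem_nonZeroDivisors (e : R ≃+* S) (I : (Ideal R)⁰) :
    (I : Ideal R).map (e : R →+* S) ∈ (Ideal S)⁰ := by
  rw [mem_nonZeroDivisors_iff_ne_zero, Ideal.zero_eq_bot, Ne,
    Ideal.map_eq_bot_iff_of_injective (f := (e : R →+* S)) e.injective]
  exact mem_nonZeroDivisors_iff_ne_zero.mp I.2

theorem mapRingEquiv_refl (c : ClassGroup R) : mapRingEquiv (RingEquiv.refl R) c = c := by
  obtain ⟨I, rfl⟩ := mk0_surjective c
  exact mapRingEquiv_mk0 _ I I (Ideal.map_id (I : Ideal R))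

theorem mapRingEquiv_trans {T : Type*} [CommRing T] [IsDedekindDomain T] (e : R ≃+* S)
    (f : S ≃+* T) (c : ClassGroup R) :
    mapRingEquiv (e.trans f) c = mapRingEquiv f (mapRingEquiv e c) := by
  obtain ⟨I, rfl⟩ := mk0_surjective c
  let J : (Ideal S)⁰ := ⟨_, map_mem_nonZeroDivisors e I⟩
  let L : (Ideal T)⁰ := ⟨_, map_mem_nonZeroDivisors f J⟩
  rw [mapRingEquiv_mk0 e I J rfl, mapRingEquiv_mk0 f J L rfl]
  exact mapRingEquiv_mk0 _ I L (Ideal.map_map (e : R →+* S) (f : S →+* T)).symm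

end Map

/-- The action of the algebra automorphisms of a Dedekind domain on its class group. -/
@[reducible]
noncomputable def algEquivAction (A R : Type*) [CommRing A] [CommRing R] [IsDedekindDomain R]
    [Algebra A R] : MulDistribMulAction (R ≃ₐ[A] R) (ClassGroup R) where
  smul σ c := mapRingEquiv σ.toRingEquiv c
  one_smul := mapRingEquiv_refl
  mul_smul σ τ := mapRingEquiv_trans τ.toRingEquiv σ.toRingEquiv
  smul_mul σ := map_mul (mapRingEquiv σ.toRingEquiv)
  smul_one σ := map_one (mapRingEquiv σ.toRingEquiv)

end ClassGroup

/-- An action by automorphisms of a finite group on a finite cyclic group is trivial if the order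
of the former is coprime to the totient of the order of the latter. -/
theorem IsCyclic.smul_eq_self_of_coprime_totient {G C : Type*} [Group G] [Group C] [Finite C]
    [IsCyclic C] [MulDistribMulAction G C]
    (h : (Nat.card G).Coprime (Nat.card C).totient) (g : G) (c : C) : g • c = c := by
  have key : MulDistribMulAction.toMulAut G C g = 1 := by
    rw [← orderOf_eq_one_iff]
    refine Nat.eq_one_of_dvd_coprimes h ?_ ?_
    · exact (orderOf_map_dvd _ g).trans (orderOf_dvd_natCard g)
    · exact IsCyclic.card_mulAut C ▸ orderOf_dvd_natCard _
  exact DFunLike.congr_fun key c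

namespace Ideal

variable {A B : Type*} [CommRing A] [IsDedekindDomain A] [CommRing B] [IsDedekindDomain B]
  [Algebra A B] [Module.Finite A B] [Module.IsTorsionFree A B]

theorem eq_top_of_relNorm_eq_top {I : Ideal B} (h : relNorm A I = ⊤) : I = ⊤ :=
  (comap_eq_top_iff (f := algebraMap A B)).mp
    (top_le_iff.mp (h.symm.trans_le (relNorm_le_comap A I)))

theorem eq_of_le_of_relNorm_eq {I J : Ideal B} (hJ : J ≠ ⊥) (hIJ : I ≤ J)
    (h : relNorm A I = relNorm A J) : I = J := by
  obtain ⟨L, rfl⟩ := dvd_iff_le.mpr hIJ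
  have hL : relNorm A L = 1 := by
    rw [map_mul] at h
    exact mul_left_cancel₀ (mt relNorm_eq_bot_iff.mp hJ) (h.trans (mul_one _).symm)
  rw [eq_top_of_relNorm_eq_top (hL.trans one_eq_top), mul_top]

attribute [local instance] FractionRing.liftAlgebra in
/-- The product of the conjugates of an ideal is the extension of its relative norm. -/
theorem prod_map_algEquiv_eq_map_relNorm [IsGalois (FractionRing A) (FractionRing B)]
    (hG : Fintype.card (B ≃ₐ[A] B) = Module.finrank A B) (I : Ideal B) :
    ∏ σ : B ≃ₐ[A] B, I.map σ = (relNorm A I).map (algebraMap A B) := by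
  rcases eq_or_ne I ⊥ with rfl | hI
  · rw [relNorm_bot, map_bot, ← zero_eq_bot]
    exact Finset.prod_eq_zero (Finset.mem_univ 1) map_bot
  refine (eq_of_le_of_relNorm_eq (A := A) ?_ ?_ ?_).symm
  · refine Finset.prod_ne_zero_iff.mpr fun σ _ ↦ ?_
    exact (map_eq_bot_iff_of_injective (f := σ) σ.injective).not.mpr hI
  · rw [map_relNorm, span_le]
    rintro _ ⟨x, hx, rfl⟩
    rw [Function.comp_apply, Algebra.algebraMap_intNorm_of_isGalois]
    exact SetLike.mem_coe.mpr (prod_mem_prod fun (σ : B ≃ₐ[A] B) _ ↦ mem_map_of_mem σ hx)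
  · simp [relNorm_algebraMap, map_prod, hG]

end Ideal

theorem statement5 (n m : ℕ) (hn : 1 < n) (hm : 1 < m) (hnm : Nat.Coprime n m)
    (hnphi : Nat.Coprime n (Nat.totient m)) :
    ∀ (K : Type) [Field K] [NumberField K] [IsGalois ℚ K],
      IsCyclic (K ≃ₐ[ℚ] K) → Module.finrank ℚ K = n →
      ¬ (IsCyclic (ClassGroup (𝓞 K)) ∧ Nat.card (ClassGroup (𝓞 K)) = m) := by
  rintro K _ _ _ - hK ⟨hcyc, hcard⟩
  have hcardG : Nat.card (𝓞 K ≃ₐ[ℤ] 𝓞 K) = n := by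
    rw [← hK, ← IsGalois.card_aut_eq_finrank, Nat.card_congr (galRestrict ℤ ℚ K (𝓞 K)).toEquiv]
  let _ := ClassGroup.algEquivAction ℤ (𝓞 K)
  let _ := FractionRing.liftAlgebra ℤ (FractionRing (𝓞 K))
  have : IsGalois (FractionRing ℤ) (FractionRing (𝓞 K)) :=
    IsGalois.of_equiv_equiv (f := (FractionRing.algEquiv ℤ ℚ).toRingEquiv.symm)
      (g := (FractionRing.algEquiv (𝓞 K) K).toRingEquiv.symm) <|
        RingHom.ext fun x ↦ IsFractionRing.algEquiv_commutes (FractionRing.algEquiv ℤ ℚ).symm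
          (FractionRing.algEquiv (𝓞 K) K).symm _
  have hpow (c : ClassGroup (𝓞 K)) : c ^ n = 1 := by
    obtain ⟨I, rfl⟩ := ClassGroup.mk0_surjective c
    have hGn : Fintype.card (𝓞 K ≃ₐ[ℤ] 𝓞 K) = n := Nat.card_eq_fintype_card.symm.trans hcardG
    let J (σ : 𝓞 K ≃ₐ[ℤ] 𝓞 K) : (Ideal (𝓞 K))⁰ :=
      ⟨_, ClassGroup.map_mem_nonZeroDivisors σ.toRingEquiv I⟩
    have hJ (σ) : ClassGroup.mk0 (J σ) = ClassGroup.mk0 I :=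
      (ClassGroup.mapRingEquiv_mk0 σ.toRingEquiv I (J σ) rfl).symm.trans
        (IsCyclic.smul_eq_self_of_coprime_totient (C := ClassGroup (𝓞 K))
          (by rwa [hcardG, hcard]) σ _)
    have hprod : ClassGroup.mk0 (∏ σ, J σ) = ClassGroup.mk0 I ^ n := by
      simp [map_prod, hJ, hGn]
    have hnorm : ((∏ σ, J σ : (Ideal (𝓞 K))⁰) : Ideal (𝓞 K)) =
        (Ideal.relNorm ℤ (I : Ideal (𝓞 K))).map (algebraMap ℤ (𝓞 K)) := by
      rw [← Ideal.prod_map_algEquiv_eq_map_relNorm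
        (hGn.trans (hK.symm.trans (RingOfIntegers.rank K).symm)), Submonoid.coe_finsetProd]
      rfl
    rw [← hprod]
    refine (ClassGroup.mk0_eq_one_iff (∏ σ, J σ).2).mpr ?_
    rw [hnorm]
    infer_instance
  have : Nontrivial (ClassGroup (𝓞 K)) := Finite.one_lt_card_iff_nontrivial.mp (hcard ▸ hm)
  obtain ⟨c, hc⟩ := exists_ne (1 : ClassGroup (𝓞 K))
  refine hc (orderOf_eq_one_iff.mp (Nat.eq_one_of_dvd_coprimes hnm ?_ ?_))
  · exact orderOf_dvd_of_pow_eq_one (hpow c)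
  · exact hcard ▸ orderOf_dvd_natCard c
end

section
/- Let K/ℚ be a cyclic Galois extension of degree n = q₁^{e₁} ⋯ q_r^{e_r}, where q₁, …, q_r are distinct primes and e_i ≥ 1. Let ℓ be a prime number not dividing n, for each i let s_i be the multiplicative order of ℓ modulo q_i, and set s = min{s₁, …, s_r}. If ℓ divides the class number h_K, then the ℓ-torsion subgroup Cl(K)[ℓ] = {c ∈ Cl(K) : c^ℓ = 1} contains a subgroup isomorphic to (ℤ/ℓℤ)^s. -/
open NumberField

section

open Pointwise nonZeroDivisors

theorem ZMod.exists_injective_addMonoidHom_pi {V : Type*} [AddCommGroup V] [Finite V] {ℓ s : ℕ}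
    [Fact ℓ.Prime] [Module (ZMod ℓ) V] (hs : ℓ ^ s ≤ Nat.card V) :
    ∃ L : (Fin s → ZMod ℓ) →+ V, Function.Injective L := by
  have hcard := Module.natCard_eq_pow_finrank (K := ZMod ℓ) (V := V)
  rw [Nat.card_zmod] at hcard
  obtain ⟨v, hv⟩ := exists_linearIndependent_of_le_finrank
    ((Nat.pow_le_pow_iff_right (Fact.out : ℓ.Prime).one_lt).1 (hcard ▸ hs))
  exact ⟨(Fintype.linearCombination (ZMod ℓ) v).toAddMonoidHom,
    hv.fintypeLinearCombination_injective⟩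

theorem Subgroup.exists_le_mulEquiv_pi_zmod {C : Type*} [CommGroup C] [Finite C] {ℓ s : ℕ}
    [Fact ℓ.Prime] (W : Subgroup C) (hW : ∀ c ∈ W, c ^ ℓ = 1) (hs : ℓ ^ s ≤ Nat.card W) :
    ∃ H ≤ W, Nonempty (H ≃* (Fin s → Multiplicative (ZMod ℓ))) := by
  have hW' : ∀ x : Additive W, ℓ • x = 0 := fun x ↦
    Additive.toMul.injective (Subtype.ext (hW x.toMul x.toMul.2))
  let _ : Module (ZMod ℓ) (Additive W) := AddCommGroup.zmodModule hW'
  obtain ⟨L, hL⟩ := ZMod.exists_injective_addMonoidHom_pi (V := Additive W) hs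
  let φ : (Fin s → Multiplicative (ZMod ℓ)) →* C :=
    { toFun x := (L fun i ↦ (x i).toAdd).toMul
      map_one' := congrArg (fun w : Additive W ↦ (w.toMul : C)) (map_zero L)
      map_mul' x y := congrArg (fun w : Additive W ↦ (w.toMul : C))
        (map_add L (fun i ↦ (x i).toAdd) fun i ↦ (y i).toAdd) }
  have hφ : Function.Injective φ := fun x y hxy ↦ hL (Subtype.ext hxy)
  refine ⟨φ.range, ?_, ⟨(MonoidHom.ofInjective hφ).symm⟩⟩
  rintro _ ⟨x, rfl⟩
  exact (L fun i ↦ (x i).toAdd).toMul.2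

theorem le_of_pow_modEq_one {ℓ p k s : ℕ} (hk : k ≠ 0) (h : ℓ ^ k ≡ 1 [MOD p])
    (hs : s ≤ orderOf (ℓ : ZMod p)) : s ≤ k := by
  refine hs.trans (Nat.le_of_dvd (Nat.pos_of_ne_zero hk) (orderOf_dvd_of_pow_eq_one ?_))
  simpa using (ZMod.natCast_eq_natCast_iff _ _ _).2 h

/-- If a self-map of a finite set has exactly one fixed point and its `p`-th iterate is the
identity, the cardinality of the set is `1` modulo the prime `p`. -/
theorem Function.natCard_modEq_one_of_iterate_eq_id {X : Type*} [Finite X] {p : ℕ} [Fact p.Prime]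
    (f : X → X) (hf : ∀ x, f^[p] x = x) (x₀ : X) (hfix : ∀ x, f x = x ↔ x = x₀) :
    Nat.card X ≡ 1 [MOD p] := by
  classical
  have := Fintype.ofFinite X
  have hpow : (show Function.End X from f) ^ p ^ 1 = 1 := by
    rw [pow_one]
    exact (hom_coe_pow (fun g : Function.End X ↦ g) rfl (fun _ _ ↦ rfl) f p).trans (funext hf)
  have h := Equiv.Perm.card_fixedPoints_modEq hpow
  have hc : Fintype.card (Function.fixedPoints f) = 1 :=
    Fintype.card_eq_one_iff.2 ⟨⟨x₀, (hfix x₀).2 rfl⟩, fun x ↦ Subtype.ext ((hfix x).1 x.2)⟩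
  rw [Nat.card_eq_fintype_card]
  exact h.trans (congrArg (· % p) hc)

theorem exists_subgroup_mulEquiv_pi_zmod_of_cyclic_action {C G : Type*} [CommGroup C] [Finite C]
    [Group G] [Finite G] [IsCyclic G] [MulDistribMulAction G C] {ℓ s : ℕ} (hℓ : ℓ.Prime)
    (hℓG : ¬ ℓ ∣ Nat.card G) (hdvd : ℓ ∣ Nat.card C)
    (hfix : ∀ c : C, (∀ g : G, g • c = c) → c ^ Nat.card G = 1)
    (hs : ∀ p : ℕ, p.Prime → p ∣ Nat.card G → s ≤ orderOf (ℓ : ZMod p)) :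
    ∃ H : Subgroup C, (∀ c ∈ H, c ^ ℓ = 1) ∧
      Nonempty (H ≃* (Fin s → Multiplicative (ZMod ℓ))) := by
  have : Fact ℓ.Prime := ⟨hℓ⟩
  obtain ⟨σ, hσ⟩ := IsCyclic.exists_generator (α := G)
  have hσn : σ ^ Nat.card G = 1 := pow_card_eq_one'
  let V (g : G) : Subgroup C :=
    { carrier := {c | c ^ ℓ = 1 ∧ g • c = c}
      one_mem' := ⟨one_pow _, smul_one _⟩
      mul_mem' := fun {a b} ha hb ↦
        ⟨by rw [mul_pow, ha.1, hb.1, one_mul], by rw [smul_mul', ha.2, hb.2]⟩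
      inv_mem' := fun {a} ha ↦ ⟨by rw [inv_pow, ha.1, inv_one], by rw [smul_inv', ha.2]⟩ }
  have hV1 : V σ = ⊥ := by
    refine (Subgroup.eq_bot_iff_forall _).2 fun c hc ↦ ?_
    have hall : ∀ g : G, g • c = c := fun g ↦
      (Subgroup.zpowers_le (H := MulAction.stabilizer G c)).2 hc.2 (hσ g)
    have h := Nat.Coprime.gcd_eq_one ((Nat.Prime.coprime_iff_not_dvd hℓ).2 hℓG)
    simpa [h] using pow_gcd_eq_one.2 ⟨hc.1, hfix c hall⟩
  have hex : ∃ d, d ∣ Nat.card G ∧ V (σ ^ d) ≠ ⊥ := by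
    refine ⟨Nat.card G, dvd_rfl, fun hbot ↦ ?_⟩
    obtain ⟨c, hc⟩ := exists_prime_orderOf_dvd_card' ℓ hdvd
    have hcV : c ∈ V (σ ^ Nat.card G) :=
      ⟨by rw [← hc, pow_orderOf_eq_one], by rw [hσn, one_smul]⟩
    rw [hbot, Subgroup.mem_bot] at hcV
    rw [hcV, orderOf_one] at hc
    exact hℓ.one_lt.ne hc
  classical
  obtain ⟨hdn, hd⟩ := Nat.find_spec hex
  have hmin := fun m ↦ Nat.find_min (m := m) hex
  generalize Nat.find hex = d at hdn hd hmin
  have hd1 : d ≠ 1 := by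
    rintro rfl
    exact hd (by rwa [pow_one])
  obtain ⟨p, hp, m, rfl⟩ := Nat.exists_prime_and_dvd hd1
  have : Fact p.Prime := ⟨hp⟩
  have hpm : 0 < p * m := Nat.pos_of_dvd_of_pos hdn Nat.card_pos
  have hm : 0 < m := Nat.pos_of_mul_pos_left hpm
  have hVm : V (σ ^ m) = ⊥ := by
    by_contra h
    exact hmin m ((Nat.lt_mul_iff_one_lt_left hm).2 hp.one_lt) ⟨(dvd_mul_left m p).trans hdn, h⟩
  set W := V (σ ^ (p * m))
  have hmaps : ∀ c ∈ W, σ ^ m • c ∈ W := fun c hc ↦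
    ⟨by rw [← smul_pow', hc.1, smul_one],
      by rw [smul_smul, ← pow_add, add_comm, pow_add, mul_smul, hc.2]⟩
  let f : W → W := fun x ↦ ⟨σ ^ m • x.1, hmaps x x.2⟩
  have hiter (k : ℕ) (x : W) : (f^[k] x : C) = σ ^ (k * m) • x.1 := by
    induction k with
    | zero => rw [zero_mul, pow_zero, one_smul, Function.iterate_zero_apply]
    | succ k ih =>
      rw [Function.iterate_succ_apply', Nat.succ_mul, add_comm, pow_add, mul_smul, ← ih]
  have hmod : Nat.card W ≡ 1 [MOD p] := by
    refine Function.natCard_modEq_one_of_iterate_eq_id f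
      (fun x ↦ Subtype.ext ((hiter p x).trans x.2.2)) 1 fun x ↦ ⟨fun hx ↦ ?_, fun hx ↦ ?_⟩
    · have hxV : x.1 ∈ V (σ ^ m) := ⟨x.2.1, congrArg Subtype.val hx⟩
      rw [hVm] at hxV
      exact Subtype.ext hxV
    · subst hx
      exact Subtype.ext (smul_one _)
  have hWℓ : ∀ c ∈ W, c ^ ℓ = 1 := fun c hc ↦ hc.1
  obtain ⟨k, hk⟩ := IsPGroup.iff_card.1
    (show IsPGroup ℓ W from fun x ↦ ⟨1, by rw [pow_one]; exact Subtype.ext (hWℓ x x.2)⟩)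
  have hk0 : k ≠ 0 := by
    rintro rfl
    exact hd (Subgroup.card_eq_one.1 (by simpa using hk))
  have hsk : s ≤ k :=
    le_of_pow_modEq_one hk0 (hk ▸ hmod) (hs p hp ((dvd_mul_right p m).trans hdn))
  obtain ⟨H, hHW, e⟩ := W.exists_le_mulEquiv_pi_zmod hWℓ
    (hk ▸ Nat.pow_le_pow_right hℓ.pos hsk)
  exact ⟨H, fun c hc ↦ hWℓ c (hHW hc), e⟩

theorem MulAction.prod_smul_eq_prod_orbit_pow {G X M : Type*} [Group G] [Fintype G]
    [MulAction G X] [CommMonoid M] (f : X → M) (x : X) [Fintype (orbit G x)] :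
    ∏ g : G, f (g • x) = (∏ y ∈ (orbit G x).toFinset, f y) ^ Nat.card (stabilizer G x) := by
  classical
  rw [Finset.prod_comp f (fun g : G ↦ g • x), ← Finset.prod_pow]
  refine Finset.prod_congr (M := M) (by ext; simp [mem_orbit_iff]) fun y hy ↦ ?_
  obtain ⟨h, rfl⟩ := mem_orbit_iff.1 (Set.mem_toFinset.1 hy)
  congr 1
  rw [Nat.card_eq_fintype_card, ← Finset.card_univ]
  refine (Finset.card_bij' (fun (g : stabilizer G x) _ ↦ h * g)
    (fun g hg ↦ ⟨h⁻¹ * g, ?_⟩) ?_ ?_ ?_ ?_).symm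
  · simpa [mul_smul, inv_smul_eq_iff] using hg
  all_goals simp [mul_smul]

section ClassGroup

variable {R : Type*} [CommRing R] [IsDedekindDomain R]

theorem ClassGroup.exists_monoidHom_mk0_eq {R S : Type*} [CommRing R] [IsDedekindDomain R]
    [CommRing S] [IsDedekindDomain S] (f : R →+* S) (hf : Function.Injective f) :
    ∃ φ : ClassGroup R →* ClassGroup S, ∀ (I : (Ideal R)⁰) (J : (Ideal S)⁰),
      (J : Ideal S) = (I : Ideal R).map f → φ (ClassGroup.mk0 I) = ClassGroup.mk0 J := by
  algebraize [f]
  have : Module.IsTorsionFree R S := by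
    rw [Module.isTorsionFree_iff_algebraMap_injective]
    exact hf
  refine ⟨ClassGroup.extendedHom R S, fun I J h ↦ ?_⟩
  rw [ClassGroup.extendedHom_mk0]
  exact congrArg _ (Subtype.ext h.symm)

variable {G : Type*} [Group G] [MulSemiringAction G R]

theorem Ideal.smul_mem_nonZeroDivisors (g : G) (I : (Ideal R)⁰) :
    g • (I : Ideal R) ∈ (Ideal R)⁰ := by
  rw [mem_nonZeroDivisors_iff_ne_zero, Ne, smul_eq_zero_iff_eq]
  exact nonZeroDivisors.ne_zero I.2

variable (R) in
/-- The endomorphism of the class group induced by an automorphism of the ring. -/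
noncomputable def ClassGroup.smulHom (g : G) : ClassGroup R →* ClassGroup R :=
  (ClassGroup.exists_monoidHom_mk0_eq (MulSemiringAction.toRingHom G R g)
    (MulAction.injective g)).choose

theorem ClassGroup.smulHom_mk0 (g : G) (I : (Ideal R)⁰) :
    ClassGroup.smulHom R g (ClassGroup.mk0 I) =
      ClassGroup.mk0 ⟨g • (I : Ideal R), Ideal.smul_mem_nonZeroDivisors g I⟩ :=
  (ClassGroup.exists_monoidHom_mk0_eq (MulSemiringAction.toRingHom G R g)
    (MulAction.injective g)).choose_spec _ _ (Ideal.pointwise_smul_def _)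

variable (R G) in
/-- The action on the class group induced by an action on the ring. -/
noncomputable abbrev ClassGroup.mulDistribMulAction : MulDistribMulAction G (ClassGroup R) where
  smul g := ClassGroup.smulHom R g
  one_smul c := by
    obtain ⟨I, rfl⟩ := ClassGroup.mk0_surjective c
    exact (ClassGroup.smulHom_mk0 1 I).trans (congrArg _ (Subtype.ext (one_smul G _)))
  mul_smul g h c := by
    obtain ⟨I, rfl⟩ := ClassGroup.mk0_surjective c
    change ClassGroup.smulHom R (g * h) _ = ClassGroup.smulHom R g (ClassGroup.smulHom R h _)
    simp only [ClassGroup.smulHom_mk0, mul_smul]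
  smul_mul g := map_mul (ClassGroup.smulHom R g)
  smul_one g := map_one (ClassGroup.smulHom R g)

theorem ClassGroup.monoidHom_eq_one_of_isPrime {M : Type*} [Monoid M] (φ : ClassGroup R →* M)
    (h : ∀ P : (Ideal R)⁰, (P : Ideal R).IsPrime → φ (ClassGroup.mk0 P) = 1) : φ = 1 := by
  ext c
  obtain ⟨⟨I, hI⟩, rfl⟩ := ClassGroup.mk0_surjective c
  rw [MonoidHom.one_apply]
  induction I using UniqueFactorizationMonoid.induction_on_prime with
  | h₁ => exact absurd rfl (nonZeroDivisors.ne_zero hI)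
  | h₂ I hu =>
    rw [show (⟨I, hI⟩ : (Ideal R)⁰) = 1 from Subtype.ext (isUnit_iff_eq_one.1 hu), map_one, map_one]
  | h₃ I P hI0 hP ih =>
    have hP' : P ∈ (Ideal R)⁰ := mem_nonZeroDivisors_of_ne_zero hP.ne_zero
    have hI' : I ∈ (Ideal R)⁰ := mem_nonZeroDivisors_of_ne_zero hI0
    rw [show (⟨P * I, hI⟩ : (Ideal R)⁰) = ⟨P, hP'⟩ * ⟨I, hI'⟩ from rfl, map_mul, map_mul,
      ih hI', mul_one]
    exact h ⟨P, hP'⟩ (Ideal.isPrime_of_prime hP)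

/-- The norm of a prime ideal in a Galois extension of a principal ideal domain is principal. -/
theorem Ideal.isPrincipal_prod_smul (A : Type*) [CommRing A] [IsDomain A]
    [IsPrincipalIdealRing A] [Algebra A R] [Module.Finite A R] [FaithfulSMul A R] [Fintype G]
    [IsGaloisGroup G A R] (P : Ideal R) [P.IsPrime] [PerfectField (P.under A).ResidueField]
    (hP : P ≠ ⊥) : (∏ g : G, g • P).IsPrincipal := by
  classical
  have : P.IsMaximal := ‹P.IsPrime›.isMaximal hP
  have hp : P.under A ≠ ⊥ := mt Ideal.eq_bot_of_comap_eq_bot hP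
  have : (P.under A).IsMaximal := inferInstance
  have horb := Algebra.IsInvariant.orbit_eq_primesOver A R G (P.under A) P
  have : Fintype ((P.under A).primesOver R) := Fintype.ofFinite _
  have : Fintype (MulAction.orbit G P) := (Set.finite_range fun g : G ↦ g • P).fintype
  have hmap : (P.under A).map (algebraMap A R) =
      (∏ Q ∈ (MulAction.orbit G P).toFinset, Q) ^ (P.under A).ramificationIdxIn R := by
    rw [Ideal.map_algebraMap_eq_finsetProd_pow hp, ← Finset.prod_pow]
    refine Finset.prod_congr (by ext; simp [horb]) fun Q hQ ↦ ?_
    have hQ' : Q ∈ (P.under A).primesOver R :=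
      horb ▸ Set.mem_toFinset.1 hQ
    have := hQ'.1
    have := hQ'.2
    rw [Ideal.ramificationIdxIn_eq_ramificationIdx (P.under A) Q G]
  rw [MulAction.prod_smul_eq_prod_orbit_pow (fun I : Ideal R ↦ I) P,
    Ideal.card_stabilizer_eq (P.under A) P, pow_mul, ← hmap, ← Ideal.map_pow]
  exact (IsPrincipalIdealRing.principal _).map_ringHom _

variable (R) in
theorem ClassGroup.prod_smulHom_eq_one (A : Type*) [CommRing A] [IsDomain A]
    [IsPrincipalIdealRing A] [Algebra A R] [Module.Finite A R] [FaithfulSMul A R] [Fintype G]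
    [IsGaloisGroup G A R] [∀ p : Ideal A, [p.IsPrime] → PerfectField p.ResidueField] :
    ∏ g : G, ClassGroup.smulHom R g = 1 := by
  refine ClassGroup.monoidHom_eq_one_of_isPrime _ fun P hP ↦ ?_
  simp only [MonoidHom.finsetProd_apply, ClassGroup.smulHom_mk0]
  rw [← map_prod]
  generalize hJ : ∏ g : G, (⟨g • (P : Ideal R), Ideal.smul_mem_nonZeroDivisors g P⟩ :
    (Ideal R)⁰) = J
  refine (ClassGroup.mk0_eq_one_iff J.2).2 ?_
  rw [← hJ, SubmonoidClass.coe_finsetProd]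
  exact Ideal.isPrincipal_prod_smul A P.1 (nonZeroDivisors.ne_zero P.2)

end ClassGroup

end


theorem statement6 (K : Type*) [Field K] [NumberField K] [IsGalois ℚ K]
    (hcyc : IsCyclic (K ≃ₐ[ℚ] K))
    (r : ℕ) (hr : 0 < r) (q e : Fin r → ℕ)
    (hq : ∀ i, (q i).Prime) (hqinj : Function.Injective q) (he : ∀ i, 1 ≤ e i)
    (hn : Module.finrank ℚ K = ∏ i, q i ^ e i)
    (ℓ : ℕ) (hℓ : ℓ.Prime) (hℓn : ¬ ℓ ∣ Module.finrank ℚ K)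
    (hdvd : ℓ ∣ classNumber K)
    (s : ℕ)
    (hs : s = Finset.univ.inf'
      (Finset.univ_nonempty_iff.mpr (Fin.pos_iff_nonempty.mp hr))
      (fun i => orderOf ((ℓ : ZMod (q i))))) :
    ∃ H : Subgroup (ClassGroup (𝓞 K)),
      (∀ c ∈ H, c ^ ℓ = 1) ∧
      Nonempty (H ≃* (Fin s → Multiplicative (ZMod ℓ))) := by
  let _ := ClassGroup.mulDistribMulAction (𝓞 K) (K ≃ₐ[ℚ] K)
  have hG : Nat.card (K ≃ₐ[ℚ] K) = Module.finrank ℚ K := IsGalois.card_aut_eq_finrank ℚ K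
  refine exists_subgroup_mulEquiv_pi_zmod_of_cyclic_action (G := K ≃ₐ[ℚ] K) hℓ (hG ▸ hℓn)
    (by rwa [Nat.card_eq_fintype_card]) (fun c hc ↦ ?_) fun p hp hpn ↦ ?_
  · have h := DFunLike.congr_fun (ClassGroup.prod_smulHom_eq_one (𝓞 K) (G := K ≃ₐ[ℚ] K) ℤ) c
    rw [MonoidHom.finsetProd_apply] at h
    have h' := (Finset.prod_congr rfl fun g _ ↦ hc g).symm.trans h
    simpa [Nat.card_eq_fintype_card] using h'
  · rw [hG, hn] at hpn
    obtain ⟨i, -, hi⟩ := (hp.prime.dvd_finsetProd_iff _).1 hpn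
    obtain rfl := (Nat.prime_dvd_prime_iff_eq hp (hq i)).1 (hp.dvd_of_dvd_pow hi)
    exact hs ▸ Finset.inf'_le _ (Finset.mem_univ i)
end
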